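/- Let k be a field of characteristic different from 2, and let F : k^n → k^n be a polynomial map each of whose coordinate functions is a polynomial of total degree at most 2. If the determinant of the Jacobian matrix of F is nonzero at every point of k^n, then F is injective. (Wang's theorem for quadratic mappings.) -/

import Mathlib

open MvPolynomial

theorem quad_mid {k : Type*} [Field k] (h2 : (2 : k) ≠ 0) {n : ℕ} (x y m : Fin n → k)
    (hm : ∀ i, 2 * m i = x i + y i) (f : MvPolynomial (Fin n) k) (hf : f.totalDegree ≤ 2) :
    eval x f - eval y f = ∑ j, eval m (pderiv j f) * (x j - y j) := by
  have hX : ∀ a j : Fin n, eval m (pderiv j (X a : MvPolynomial (Fin n) k))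
      = if j = a then 1 else 0 := by
    intro a j
    by_cases h : j = a
    · subst h
      simp
    · rw [pderiv_X_of_ne (Ne.symm h)]
      simp [h]
  have mono : ∀ s ∈ f.support, ∀ c : k, eval x (monomial s c) - eval y (monomial s c)
      = ∑ j, eval m (pderiv j (monomial s c)) * (x j - y j) := by
    intro s hs c
    have hd : Multiset.card (Finsupp.toMultiset s) ≤ 2 := by
      rw [Finsupp.card_toMultiset]
      exact (le_totalDegree hs).trans hf
    obtain ⟨t, rfl⟩ : ∃ t : Multiset (Fin n), s = Multiset.toFinsupp t :=
      ⟨Finsupp.toMultiset s, by simp⟩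
    rw [Multiset.toFinsupp_toMultiset] at hd
    have h3 : Multiset.card t = 0 ∨ Multiset.card t = 1 ∨ Multiset.card t = 2 := by omega
    rcases h3 with h | h | h
    · rw [Multiset.card_eq_zero] at h
      subst h
      have : (monomial (Multiset.toFinsupp (0 : Multiset (Fin n))) c) = C c := by
        simp
      rw [this]
      simp
    · rw [Multiset.card_eq_one] at h
      obtain ⟨a, rfl⟩ := h
      have : (monomial (Multiset.toFinsupp ({a} : Multiset (Fin n))) c) = C c * X a := by
        rw [C_mul_X_eq_monomial, Multiset.toFinsupp_singleton]
      rw [this]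
      simp [pderiv_C_mul, -pderiv_X, hX, mul_sub]
    · rw [Multiset.card_eq_two] at h
      obtain ⟨a, b, rfl⟩ := h
      have : (monomial (Multiset.toFinsupp ({a, b} : Multiset (Fin n))) c)
          = C c * (X a * X b) := by
        rw [← mul_assoc, C_mul_X_eq_monomial, X, monomial_mul, mul_one,
          Multiset.insert_eq_cons, ← Multiset.singleton_add, map_add,
          Multiset.toFinsupp_singleton, Multiset.toFinsupp_singleton]
      rw [this]
      have hr : ∑ j, eval m (pderiv j (C c * (X a * X b))) * (x j - y j)
          = c * (m a * (x b - y b) + m b * (x a - y a)) := by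
        simp [pderiv_C_mul, -pderiv_X, pderiv_mul, hX, mul_add, add_mul, Finset.sum_add_distrib]
        ring
      rw [hr]
      simp only [map_mul, eval_C, eval_X]
      apply mul_left_cancel₀ h2
      linear_combination (-c) * (x b - y b) * hm a - c * (x a - y a) * hm b
  have key : ∀ g : MvPolynomial (Fin n) k, g = ∑ v ∈ f.support, monomial v (coeff v f) →
      eval x g - eval y g = ∑ j, eval m (pderiv j g) * (x j - y j) := by
    rintro g rfl
    simp only [map_sum, Finset.sum_mul]
    rw [← Finset.sum_sub_distrib, Finset.sum_comm]
    exact Finset.sum_congr rfl fun s hs => mono s hs _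
  exact key f f.as_sum

/-- Wang's theorem for quadratic mappings: a polynomial map of degree ≤ 2 whose
Jacobian determinant vanishes nowhere is injective (char k ≠ 2). -/
theorem wang_quadratic_injective (k : Type*) [Field k] (hchar : ringChar k ≠ 2)
    (n : ℕ) (f : Fin n → MvPolynomial (Fin n) k)
    (hdeg : ∀ i, (f i).totalDegree ≤ 2)
    (hjac : ∀ p : Fin n → k,
      Matrix.det (Matrix.of fun i j : Fin n => eval p (pderiv j (f i))) ≠ 0) :
    Function.Injective (fun p : Fin n → k => fun i => eval p (f i)) := by
  intro x y hxy
  have h2 : (2 : k) ≠ 0 := Ring.two_ne_zero hchar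
  have h0 := Matrix.eq_zero_of_mulVec_eq_zero (hjac fun i => (x i + y i) / 2)
    (v := x - y) (by
      ext i
      have h := quad_mid h2 x y (fun i => (x i + y i) / 2)
        (fun i => by field_simp) (f i) (hdeg i)
      have h' : eval x (f i) = eval y (f i) := congrFun hxy i
      rw [h', sub_self] at h
      simpa [Matrix.mulVec, dotProduct] using h.symm)
  exact sub_eq_zero.mp h0
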